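/- Let v ∈ ℕ^m with v_0, v_{m-1} ≥ 1. A digital convex set S ⊆ [0,m-1]×ℤ with vertical X-ray v exists if and only if there exists a path from the set Left to the set Right in the directed acyclic graph Γ(v) whose nodes are quads (pairs of non-vertical segments with integer endpoints in the bounded region R_v, in convex position, overlapping in a nonempty interval of x-coordinates, and containing exactly v_i integer points in each common column i) and whose edges connect quads sharing one segment whose other segments are consecutive and form a convex turn. -/

import Mathlib

/-- Digital convexity: `S = conv_ℝ²(S) ∩ ℤ²`. -/
def DigitalConvex (S : Finset (ℤ × ℤ)) : Prop :=
  ∀ p : ℤ × ℤ,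
    ((p.1 : ℝ), (p.2 : ℝ)) ∈ convexHull ℝ ((fun q : ℤ × ℤ => ((q.1 : ℝ), (q.2 : ℝ))) '' ↑S) →
    p ∈ S

/-- Cross product of two lattice vectors. -/
def cross (u w : ℤ × ℤ) : ℤ := u.1 * w.2 - u.2 * w.1

/-- Membership in the bounded region `R_v`: column `i` of `R_v` consists of the points at
vertical distance at most `v i - 1` from the triangle `T_m` (whose column `i` is `[0, i]`). -/
def InRv (m : ℕ) (v : Fin m → ℕ) (p : ℤ × ℤ) : Prop :=
  ∃ i : Fin m, p.1 = (i : ℤ) ∧ 1 - (v i : ℤ) ≤ p.2 ∧ p.2 ≤ (i : ℤ) + (v i : ℤ) - 1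

/-- The `y`-coordinate (as a rational) of the point of abscissa `x` on the line through
`a` and `b`. -/
def yLine (a b : ℤ × ℤ) (x : ℤ) : ℚ :=
  (a.2 : ℚ) + ((x : ℚ) - (a.1 : ℚ)) * ((b.2 : ℚ) - (a.2 : ℚ)) / ((b.1 : ℚ) - (a.1 : ℚ))

/-- A node of the DAG `Γ(v)`: a quad given by a lower segment `pl–pr` and an upper
segment `ql–qr`, both non-vertical with endpoints in `R_v`, the four vertices in convex
position, a nonempty common interval of abscissas, and containing exactly `v i` lattice
points in each common column `i`. -/
structure Quad (m : ℕ) (v : Fin m → ℕ) where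
  pl : ℤ × ℤ
  pr : ℤ × ℤ
  ql : ℤ × ℤ
  qr : ℤ × ℤ
  lower_nonvert : pl.1 < pr.1
  upper_nonvert : ql.1 < qr.1
  pl_mem : InRv m v pl
  pr_mem : InRv m v pr
  ql_mem : InRv m v ql
  qr_mem : InRv m v qr
  convex_pos :
    0 ≤ cross (pr - pl) (qr - pr) ∧ 0 ≤ cross (qr - pr) (ql - qr) ∧
    0 ≤ cross (ql - qr) (pl - ql) ∧ 0 ≤ cross (pl - ql) (pr - pl)
  overlap : max pl.1 ql.1 ≤ min pr.1 qr.1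
  count : ∀ i : Fin m, max pl.1 ql.1 ≤ (i : ℤ) → (i : ℤ) ≤ min pr.1 qr.1 →
    ⌊yLine ql qr (i : ℤ)⌋ - ⌈yLine pl pr (i : ℤ)⌉ + 1 = (v i : ℤ)

/-- An edge of `Γ(v)`: the two quads share one segment, the two other segments are
consecutive and make a strictly convex turn. -/
def QuadEdge {m : ℕ} {v : Fin m → ℕ} (q₁ q₂ : Quad m v) : Prop :=
  (q₁.pl = q₂.pl ∧ q₁.pr = q₂.pr ∧ q₁.qr = q₂.ql ∧
    cross (q₁.qr - q₁.ql) (q₂.qr - q₂.ql) < 0) ∨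
  (q₁.ql = q₂.ql ∧ q₁.qr = q₂.qr ∧ q₁.pr = q₂.pl ∧
    0 < cross (q₁.pr - q₁.pl) (q₂.pr - q₂.pl))


/-! ### Backward direction -/

/-- slope and intercept of the line through `a` and `b` -/
def lineOf (a b : ℤ × ℤ) : ℚ × ℚ :=
  (((b.2 : ℚ) - (a.2 : ℚ)) / ((b.1 : ℚ) - (a.1 : ℚ)),
    (a.2 : ℚ) - (a.1 : ℚ) * (((b.2 : ℚ) - (a.2 : ℚ)) / ((b.1 : ℚ) - (a.1 : ℚ))))

/-- evaluation of an affine function -/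
def evL (l : ℚ × ℚ) (x : ℤ) : ℚ := l.1 * x + l.2

lemma evL_lineOf (a b : ℤ × ℤ) (x : ℤ) : evL (lineOf a b) x = yLine a b x := by
  unfold evL lineOf yLine
  ring

lemma yLine_le_iff (a b : ℤ × ℤ) (h : a.1 < b.1) (x y : ℤ) :
    yLine a b x ≤ y ↔ 0 ≤ cross (b - a) ((x, y) - a) := by
  have h' : (0 : ℚ) < (b.1 : ℚ) - a.1 := by
    have : (a.1 : ℚ) < b.1 := by exact_mod_cast h
    linarith
  have : (0 ≤ cross (b - a) ((x, y) - a)) ↔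
      (0 : ℚ) ≤ (b.1 - a.1) * (y - a.2) - (b.2 - a.2) * (x - a.1) := by
    unfold cross
    simp only [Prod.fst_sub, Prod.snd_sub]
    exact_mod_cast Iff.rfl
  rw [this]
  unfold yLine
  rw [← le_sub_iff_add_le', div_le_iff₀ h']
  constructor <;> intro h <;> linarith

lemma le_yLine_iff (a b : ℤ × ℤ) (h : a.1 < b.1) (x y : ℤ) :
    y ≤ yLine a b x ↔ cross (b - a) ((x, y) - a) ≤ 0 := by
  have h' : (0 : ℚ) < (b.1 : ℚ) - a.1 := by
    have : (a.1 : ℚ) < b.1 := by exact_mod_cast h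
    linarith
  have : (cross (b - a) ((x, y) - a) ≤ 0) ↔
      (b.1 - a.1) * (y - a.2) - (b.2 - a.2) * (x - a.1) ≤ (0 : ℚ) := by
    unfold cross
    simp only [Prod.fst_sub, Prod.snd_sub]
    exact_mod_cast Iff.rfl
  rw [this]
  unfold yLine
  rw [← sub_le_iff_le_add', le_div_iff₀ h']
  constructor <;> intro h <;> linarith

lemma slope_lt_of_cross {a b c : ℤ × ℤ} (hab : a.1 < b.1) (hbc : b.1 < c.1)
    (h : 0 ≤ cross (b - a) (c - b)) :
    ((b.2 : ℚ) - a.2) / (b.1 - a.1) ≤ ((c.2 : ℚ) - b.2) / (c.1 - b.1) := by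
  have h1 : (0 : ℚ) < (b.1 : ℚ) - a.1 := by
    have : (a.1 : ℚ) < b.1 := by exact_mod_cast hab
    linarith
  have h2 : (0 : ℚ) < (c.1 : ℚ) - b.1 := by
    have : (b.1 : ℚ) < c.1 := by exact_mod_cast hbc
    linarith
  have h3 : (0 : ℚ) ≤ (b.1 - a.1) * (c.2 - b.2) - (b.2 - a.2) * (c.1 - b.1) := by
    unfold cross at h
    simp only [Prod.fst_sub, Prod.snd_sub] at h
    exact_mod_cast h
  rw [div_le_div_iff₀ h1 h2]
  linarith

lemma slope_lt_of_cross' {a b c : ℤ × ℤ} (hab : a.1 < b.1) (hbc : b.1 < c.1)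
    (h : cross (b - a) (c - b) ≤ 0) :
    ((c.2 : ℚ) - b.2) / (c.1 - b.1) ≤ ((b.2 : ℚ) - a.2) / (b.1 - a.1) := by
  have h1 : (0 : ℚ) < (b.1 : ℚ) - a.1 := by
    have : (a.1 : ℚ) < b.1 := by exact_mod_cast hab
    linarith
  have h2 : (0 : ℚ) < (c.1 : ℚ) - b.1 := by
    have : (b.1 : ℚ) < c.1 := by exact_mod_cast hbc
    linarith
  have h3 : (b.1 - a.1) * (c.2 - b.2) - (b.2 - a.2) * (c.1 - b.1) ≤ (0 : ℚ) := by
    unfold cross at h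
    simp only [Prod.fst_sub, Prod.snd_sub] at h
    exact_mod_cast h
  rw [div_le_div_iff₀ h2 h1]
  linarith

lemma evL_expand_right {a b : ℤ × ℤ} (hab : a.1 < b.1) (x : ℤ) :
    evL (lineOf a b) x = b.2 + (x - b.1) * (((b.2 : ℚ) - a.2) / (b.1 - a.1)) := by
  have h1 : (0 : ℚ) < (b.1 : ℚ) - a.1 := by
    have : (a.1 : ℚ) < b.1 := by exact_mod_cast hab
    linarith
  unfold evL lineOf
  simp only
  field_simp
  ring

lemma evL_expand_left (a b : ℤ × ℤ) (x : ℤ) :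
    evL (lineOf a b) x = a.2 + (x - a.1) * (((b.2 : ℚ) - a.2) / (b.1 - a.1)) := by
  unfold evL lineOf
  simp only
  ring

lemma turn_lower {a b c : ℤ × ℤ} (hab : a.1 < b.1) (hbc : b.1 < c.1)
    (h : 0 ≤ cross (b - a) (c - b)) (x : ℤ) :
    (b.1 ≤ x → evL (lineOf a b) x ≤ evL (lineOf b c) x) ∧
    (x ≤ b.1 → evL (lineOf b c) x ≤ evL (lineOf a b) x) := by
  have hs := slope_lt_of_cross hab hbc h
  rw [evL_expand_right hab, evL_expand_left b c]
  constructor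
  · intro hx
    have : (0 : ℚ) ≤ x - b.1 := by
      have : (b.1 : ℚ) ≤ x := by exact_mod_cast hx
      linarith
    have := mul_le_mul_of_nonneg_left hs this
    linarith
  · intro hx
    have : (0 : ℚ) ≤ b.1 - x := by
      have : (x : ℚ) ≤ b.1 := by exact_mod_cast hx
      linarith
    have := mul_le_mul_of_nonneg_left hs this
    linarith

lemma turn_upper {a b c : ℤ × ℤ} (hab : a.1 < b.1) (hbc : b.1 < c.1)
    (h : cross (b - a) (c - b) ≤ 0) (x : ℤ) :
    (b.1 ≤ x → evL (lineOf b c) x ≤ evL (lineOf a b) x) ∧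
    (x ≤ b.1 → evL (lineOf a b) x ≤ evL (lineOf b c) x) := by
  have hs := slope_lt_of_cross' hab hbc h
  rw [evL_expand_right hab, evL_expand_left b c]
  constructor
  · intro hx
    have : (0 : ℚ) ≤ x - b.1 := by
      have : (b.1 : ℚ) ≤ x := by exact_mod_cast hx
      linarith
    have := mul_le_mul_of_nonneg_left hs this
    linarith
  · intro hx
    have : (0 : ℚ) ≤ b.1 - x := by
      have : (x : ℚ) ≤ b.1 := by exact_mod_cast hx
      linarith
    have := mul_le_mul_of_nonneg_left hs this
    linarith

/-- invariant along a path -/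
def PathInv {m : ℕ} {v : Fin m → ℕ} (q : Quad m v) (A B : Set (ℚ × ℚ)) : Prop :=
  lineOf q.pl q.pr ∈ A ∧ lineOf q.ql q.qr ∈ B ∧
  (∀ l ∈ A, ∀ x : ℤ, q.pl.1 ≤ x → evL l x ≤ evL (lineOf q.pl q.pr) x) ∧
  (∀ u ∈ B, ∀ x : ℤ, q.ql.1 ≤ x → evL (lineOf q.ql q.qr) x ≤ evL u x) ∧
  (∀ i : Fin m, (i : ℤ) ≤ min q.pr.1 q.qr.1 →
    ∃ l ∈ A, ∃ u ∈ B, (∀ l' ∈ A, evL l' i ≤ evL l i) ∧ (∀ u' ∈ B, evL u i ≤ evL u' i) ∧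
      ⌊evL u i⌋ - ⌈evL l i⌉ + 1 = (v i : ℤ))

lemma pathInv_exists {m : ℕ} {v : Fin m → ℕ} (a b : Quad m v)
    (ha : a.pl.1 = 0) (ha' : a.ql.1 = 0) (h : Relation.ReflTransGen QuadEdge a b) :
    ∃ A B, PathInv b A B := by
  induction h with
  | refl =>
    refine ⟨{lineOf a.pl a.pr}, {lineOf a.ql a.qr}, rfl, rfl, ?_, ?_, ?_⟩
    · rintro l rfl x _; exact le_rfl
    · rintro l rfl x _; exact le_rfl
    · intro i hi
      refine ⟨_, rfl, _, rfl, ?_, ?_, ?_⟩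
      · rintro l rfl; exact le_rfl
      · rintro l rfl; exact le_rfl
      · rw [evL_lineOf, evL_lineOf]
        apply a.count i _ hi
        rw [ha, ha']; simp
  | @tail q r _ he ih =>
    obtain ⟨A, B, hA, hB, hAd, hBd, hc⟩ := ih
    have o1 := q.overlap
    have o2 := r.overlap
    have n1 := q.lower_nonvert
    have n2 := q.upper_nonvert
    have n3 := r.lower_nonvert
    have n4 := r.upper_nonvert
    rcases he with ⟨e1, e2, e3, e4⟩ | ⟨e1, e2, e3, e4⟩
    · have ht := turn_upper (a := q.ql) (b := q.qr) (c := r.qr) n2 (by rw [e3]; exact n4)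
        (by rw [← e3] at e4; exact e4.le)
      refine ⟨A, insert (lineOf r.ql r.qr) B, ?_, Set.mem_insert _ _, ?_, ?_, ?_⟩
      · rw [← e1, ← e2]; exact hA
      · rw [← e1, ← e2]; exact hAd
      · have key : ∀ u ∈ insert (lineOf r.ql r.qr) B, ∀ x : ℤ, r.ql.1 ≤ x →
            evL (lineOf r.ql r.qr) x ≤ evL u x := by
          intro u hu x hx
          rcases hu with rfl | hu
          · exact le_rfl
          · rw [← e3] at hx ⊢
            exact ((ht x).1 hx).trans (hBd u hu x (by omega))
        exact key
      · intro i hi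
        by_cases hi' : (i : ℤ) ≤ min q.pr.1 q.qr.1
        · obtain ⟨l, hl, u, hu, h1, h2, h3⟩ := hc i hi'
          refine ⟨l, hl, u, Set.mem_insert_of_mem _ hu, h1, ?_, h3⟩
          rintro u' (rfl | hu')
          · rw [← e3]
            exact (h2 _ hB).trans ((ht i).2 (by omega))
          · exact h2 u' hu'
        · have hq : r.ql.1 ≤ (i : ℤ) := by
            rw [e3, e2] at hi'
            omega
          have hp : r.pl.1 ≤ (i : ℤ) := by
            rw [e3, e2] at hi'
            rw [e1, e3, e2] at o1
            omega
          refine ⟨lineOf r.pl r.pr, by rw [← e1, ← e2]; exact hA, lineOf r.ql r.qr,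
            Set.mem_insert _ _, ?_, ?_, ?_⟩
          · intro l hl
            have := hAd l hl i (by rw [e1]; exact hp)
            rwa [e1, e2] at this
          · rintro u (rfl | hu)
            · exact le_rfl
            · rw [← e3] at hq ⊢
              exact ((ht i).1 hq).trans (hBd u hu i (by omega))
          · rw [evL_lineOf, evL_lineOf]
            exact r.count i (max_le hp hq) hi
    · have ht := turn_lower (a := q.pl) (b := q.pr) (c := r.pr) n1 (by rw [e3]; exact n3)
        (by rw [← e3] at e4; exact e4.le)
      refine ⟨insert (lineOf r.pl r.pr) A, B, Set.mem_insert _ _, ?_, ?_, ?_, ?_⟩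
      · rw [← e1, ← e2]; exact hB
      · intro u hu x hx
        rcases hu with rfl | hu
        · exact le_rfl
        · rw [← e3] at hx ⊢
          exact (hAd u hu x (by omega)).trans ((ht x).1 hx)
      · rw [← e1, ← e2]; exact hBd
      · intro i hi
        by_cases hi' : (i : ℤ) ≤ min q.pr.1 q.qr.1
        · obtain ⟨l, hl, u, hu, h1, h2, h3⟩ := hc i hi'
          refine ⟨l, Set.mem_insert_of_mem _ hl, u, hu, ?_, h2, h3⟩
          rintro u' (rfl | hu')
          · rw [← e3]
            exact ((ht i).2 (by omega)).trans (h1 _ hA)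
          · exact h1 u' hu'
        · have hq : r.pl.1 ≤ (i : ℤ) := by
            rw [e3, e2] at hi'
            omega
          have hp : r.ql.1 ≤ (i : ℤ) := by
            rw [e3, e2] at hi'
            rw [e1, e3, e2] at o1
            omega
          refine ⟨lineOf r.pl r.pr, Set.mem_insert _ _, lineOf r.ql r.qr,
            by rw [← e1, ← e2]; exact hB, ?_, ?_, ?_⟩
          · rintro u (rfl | hu)
            · exact le_rfl
            · rw [← e3] at hq ⊢
              exact (hAd u hu i (by omega)).trans ((ht i).1 hq)
          · intro l hl
            have := hBd l hl i (by rw [e1]; exact hp)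
            rwa [e1, e2] at this
          · rw [evL_lineOf, evL_lineOf]
            exact r.count i (max_le hq hp) hi

/-- the real region cut out by the half planes -/
def region (A B : Set (ℚ × ℚ)) (N : ℝ) : Set (ℝ × ℝ) :=
  {z | 0 ≤ z.1 ∧ z.1 ≤ N ∧ (∀ l ∈ A, (l.1 : ℝ) * z.1 + l.2 ≤ z.2) ∧
    (∀ u ∈ B, z.2 ≤ (u.1 : ℝ) * z.1 + u.2)}

lemma region_convex (A B : Set (ℚ × ℚ)) (N : ℝ) : Convex ℝ (region A B N) := by
  rintro ⟨x1, y1⟩ ⟨h1, h2, h3, h4⟩ ⟨x2, y2⟩ ⟨k1, k2, k3, k4⟩ s t hs ht hst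
  simp only at h1 h2 h3 h4 k1 k2 k3 k4
  refine ⟨?_, ?_, ?_, ?_⟩
  · simp only [Prod.smul_mk, Prod.mk_add_mk, smul_eq_mul]; positivity
  · simp only [Prod.smul_mk, Prod.mk_add_mk, smul_eq_mul]
    have : s * x1 + t * x2 ≤ s * N + t * N := by gcongr
    rw [← add_mul, hst, one_mul] at this
    exact this
  · intro l hl
    simp only [Prod.smul_mk, Prod.mk_add_mk, smul_eq_mul]
    have e1 := mul_le_mul_of_nonneg_left (h3 l hl) hs
    have e2 := mul_le_mul_of_nonneg_left (k3 l hl) ht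
    have : (l.2 : ℝ) = s * l.2 + t * l.2 := by rw [← add_mul, hst, one_mul]
    rw [this]
    linarith
  · intro l hl
    simp only [Prod.smul_mk, Prod.mk_add_mk, smul_eq_mul]
    have e1 := mul_le_mul_of_nonneg_left (h4 l hl) hs
    have e2 := mul_le_mul_of_nonneg_left (k4 l hl) ht
    have : (l.2 : ℝ) = s * l.2 + t * l.2 := by rw [← add_mul, hst, one_mul]
    rw [this]
    linarith

lemma backward (m : ℕ) (v : Fin m → ℕ) (b : Quad m v) (A B : Set (ℚ × ℚ))
    (hb1 : b.pr.1 = (m : ℤ) - 1) (hb2 : b.qr.1 = (m : ℤ) - 1) (h : PathInv b A B) :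
    ∃ S : Finset (ℤ × ℤ), DigitalConvex S ∧
      (∀ p ∈ S, 0 ≤ p.1 ∧ p.1 ≤ (m : ℤ) - 1) ∧
      (∀ i : Fin m, (S.filter (fun p => p.1 = (i : ℤ))).card = v i) := by
  obtain ⟨-, -, -, -, hc⟩ := h
  have hc' : ∀ i : Fin m, ∃ lo hi : ℤ, (∀ y : ℤ, (lo ≤ y ∧ y ≤ hi) ↔
      ((∀ l ∈ A, evL l i ≤ y) ∧ (∀ u ∈ B, y ≤ evL u i))) ∧ hi - lo + 1 = (v i : ℤ) := by
    intro i
    obtain ⟨l, hl, u, hu, h1, h2, h3⟩ := hc i (by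
      have := i.2
      rw [hb1, hb2]; omega)
    refine ⟨_, _, ?_, h3⟩
    intro y
    rw [Int.ceil_le, Int.le_floor]
    constructor
    · rintro ⟨ha, hb⟩
      exact ⟨fun l' hl' => (h1 l' hl').trans ha, fun u' hu' => hb.trans (h2 u' hu')⟩
    · rintro ⟨ha, hb⟩
      exact ⟨ha l hl, hb u hu⟩
  choose lo hi hmem hcard using hc'
  let S : Finset (ℤ × ℤ) := Finset.univ.biUnion fun i : Fin m =>
    (Finset.Icc (lo i) (hi i)).image fun y => ((i : ℤ), y)
  have hS : ∀ p : ℤ × ℤ, p ∈ S ↔ ∃ i : Fin m, p.1 = (i : ℤ) ∧ lo i ≤ p.2 ∧ p.2 ≤ hi i := by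
    intro p
    simp only [S, Finset.mem_biUnion, Finset.mem_univ, true_and, Finset.mem_image, Finset.mem_Icc]
    constructor
    · rintro ⟨i, y, hy, rfl⟩
      exact ⟨i, rfl, hy⟩
    · rintro ⟨i, hi, hy⟩
      exact ⟨i, p.2, hy, by rw [← hi]⟩
  refine ⟨S, ?_, ?_, ?_⟩
  · intro p hp
    have hsub : ((fun q : ℤ × ℤ => ((q.1 : ℝ), (q.2 : ℝ))) '' ↑S) ⊆ region A B ((m : ℝ) - 1) := by
      rintro _ ⟨q, hq, rfl⟩
      rw [Finset.mem_coe, hS] at hq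
      obtain ⟨i, hi1, hi2⟩ := hq
      rw [hmem] at hi2
      have him : ((i : ℕ) : ℝ) + 1 ≤ m := by exact_mod_cast i.2
      refine ⟨?_, ?_, ?_, ?_⟩
      · simp [hi1]
      · simp only [hi1, Int.cast_natCast]; linarith
      · intro l hl
        have := hi2.1 l hl
        simp only [hi1]
        unfold evL at this
        exact_mod_cast this
      · intro l hl
        have := hi2.2 l hl
        simp only [hi1]
        unfold evL at this
        exact_mod_cast this
    obtain ⟨h1, h2, h3, h4⟩ := convexHull_min hsub (region_convex A B _) hp
    simp only at h1 h2 h3 h4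
    have h1' : 0 ≤ p.1 := by exact_mod_cast h1
    have h2' : p.1 + 1 ≤ m := by
      have : (p.1 : ℝ) + 1 ≤ m := by linarith
      exact_mod_cast this
    obtain ⟨n, hn⟩ := Int.eq_ofNat_of_zero_le h1'
    rw [hS]
    refine ⟨⟨n, by omega⟩, hn, ?_⟩
    rw [hmem]
    constructor
    · intro l hl
      have := h3 l hl
      unfold evL
      simp only
      rw [hn] at this
      exact_mod_cast this
    · intro l hl
      have := h4 l hl
      unfold evL
      simp only
      rw [hn] at this
      exact_mod_cast this
  · intro p hp
    rw [hS] at hp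
    obtain ⟨i, h1, -⟩ := hp
    have := i.2
    omega
  · intro i
    have : S.filter (fun p => p.1 = (i : ℤ)) =
        (Finset.Icc (lo i) (hi i)).image fun y => ((i : ℤ), y) := by
      ext p
      rw [Finset.mem_filter, hS]
      simp only [Finset.mem_image, Finset.mem_Icc]
      constructor
      · rintro ⟨⟨j, h1, h2⟩, h3⟩
        have : j = i := by
          apply Fin.ext
          omega
        subst this
        exact ⟨p.2, h2, by rw [← h1]⟩
      · rintro ⟨y, hy, rfl⟩
        exact ⟨⟨i, rfl, hy⟩, rfl⟩
    rw [this, Finset.card_image_of_injective _ (by intro a b h; simpa using h), Int.card_Icc]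
    have := hcard i
    omega

/-! ### Forward direction -/

/-- embedding of the lattice in the plane -/
def emb (q : ℤ × ℤ) : ℝ × ℝ := ((q.1 : ℝ), (q.2 : ℝ))

lemma fill {S : Finset (ℤ × ℤ)} (hS : DigitalConvex S) (x y : ℤ) (y1 y2 : ℝ)
    (h1 : ((x : ℝ), y1) ∈ convexHull ℝ (emb '' ↑S))
    (h2 : ((x : ℝ), y2) ∈ convexHull ℝ (emb '' ↑S)) (h3 : y1 ≤ y) (h4 : y ≤ y2) :
    (x, y) ∈ S := by
  apply hS
  change _ ∈ convexHull ℝ (emb '' ↑S)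
  have hseg := (convex_convexHull ℝ (emb '' (S : Set (ℤ × ℤ)))).segment_subset h1 h2
  apply hseg
  have : (y : ℝ) ∈ segment ℝ y1 y2 := by
    rw [segment_eq_Icc (h3.trans h4)]; exact ⟨h3, h4⟩
  obtain ⟨s, t, hs, ht, hst, h⟩ := this
  refine ⟨s, t, hs, ht, hst, ?_⟩
  simp only [Prod.smul_mk, Prod.mk_add_mk, Prod.mk.injEq]
  refine ⟨?_, h⟩
  rw [smul_eq_mul, smul_eq_mul, ← add_mul, hst, one_mul]

lemma seg_mem {S : Finset (ℤ × ℤ)} {a b : ℤ × ℤ} (ha : a ∈ S) (hb : b ∈ S) (hab : a.1 < b.1)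
    (x : ℤ) (h1 : a.1 ≤ x) (h2 : x ≤ b.1) :
    ((x : ℝ), ((yLine a b x : ℚ) : ℝ)) ∈ convexHull ℝ (emb '' (S : Set (ℤ × ℤ))) := by
  have ha' : emb a ∈ convexHull ℝ (emb '' (S : Set (ℤ × ℤ))) :=
    subset_convexHull ℝ _ ⟨a, ha, rfl⟩
  have hb' : emb b ∈ convexHull ℝ (emb '' (S : Set (ℤ × ℤ))) :=
    subset_convexHull ℝ _ ⟨b, hb, rfl⟩
  have hseg := (convex_convexHull ℝ (emb '' (S : Set (ℤ × ℤ)))).segment_subset ha' hb'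
  apply hseg
  have hab' : (a.1 : ℝ) < b.1 := by exact_mod_cast hab
  have h1' : (a.1 : ℝ) ≤ x := by exact_mod_cast h1
  have h2' : (x : ℝ) ≤ b.1 := by exact_mod_cast h2
  have hd : (0 : ℝ) < b.1 - a.1 := by linarith
  refine ⟨(b.1 - x) / (b.1 - a.1), (x - a.1) / (b.1 - a.1), div_nonneg (by linarith) hd.le,
    div_nonneg (by linarith) hd.le, ?_, ?_⟩
  · field_simp
    ring
  · unfold emb yLine
    simp only [Prod.smul_mk, Prod.mk_add_mk, Prod.mk.injEq, smul_eq_mul]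
    push_cast
    constructor
    · field_simp
      ring
    · field_simp
      ring

/-- hull edge; `e = 1` for lower edges and `e = -1` for upper edges -/
def HEdge (e : ℤ) (S : Finset (ℤ × ℤ)) (p r : ℤ × ℤ) : Prop :=
  p ∈ S ∧ r ∈ S ∧ p.1 < r.1 ∧
    ∀ s ∈ S, 0 ≤ e * cross (r - p) (s - p) ∧ (cross (r - p) (s - p) = 0 → s.1 ≤ r.1)

lemma next_point (e : ℤ) (S : Finset (ℤ × ℤ)) (p : ℤ × ℤ) (h : ∃ s ∈ S, p.1 < s.1) :
    ∃ t ∈ S, p.1 < t.1 ∧ ∀ s ∈ S, p.1 < s.1 →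
      0 ≤ e * cross (t - p) (s - p) ∧ (cross (t - p) (s - p) = 0 → s.1 ≤ t.1) := by
  let T := S.filter fun s => p.1 < s.1
  have hT : ∀ s, s ∈ T ↔ s ∈ S ∧ p.1 < s.1 := by intro s; simp [T]
  let f : ℤ × ℤ → ℚ := fun s => e * ((s.2 : ℚ) - p.2) / (s.1 - p.1)
  have hTn : T.Nonempty := by
    obtain ⟨s, hs⟩ := h
    exact ⟨s, (hT s).2 hs⟩
  obtain ⟨t0, ht0, hmin⟩ := T.exists_min_image f hTn
  let T' := T.filter fun s => f s = f t0
  obtain ⟨t, ht, hmax⟩ := T'.exists_max_image (fun s => s.1) ⟨t0, by simp [T', ht0]⟩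
  simp only [T', Finset.mem_filter] at ht hmax
  have htS := (hT t).1 ht.1
  have hpos : ∀ s : ℤ × ℤ, p.1 < s.1 → (0 : ℚ) < s.1 - p.1 := by
    intro s hs
    have : (p.1 : ℚ) < s.1 := by exact_mod_cast hs
    linarith
  have hcast : ∀ s : ℤ × ℤ, ((e * cross (t - p) (s - p) : ℤ) : ℚ) =
      e * ((t.1 - p.1) * (s.2 - p.2) - (t.2 - p.2) * (s.1 - p.1)) := by
    intro s
    unfold cross
    simp only [Prod.fst_sub, Prod.snd_sub]
    push_cast
    ring
  refine ⟨t, htS.1, htS.2, ?_⟩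
  intro s hs hps
  have hsT : s ∈ T := (hT s).2 ⟨hs, hps⟩
  have h1 := hpos s hps
  have h2 := hpos t htS.2
  have hle : f t ≤ f s := by rw [ht.2]; exact hmin s hsT
  constructor
  · have : (0 : ℚ) ≤ ((e * cross (t - p) (s - p) : ℤ) : ℚ) := by
      rw [hcast]
      simp only [f] at hle
      rw [div_le_div_iff₀ h2 h1] at hle
      linarith
    exact_mod_cast this
  · intro h0
    apply hmax s ⟨hsT, ?_⟩
    rw [← ht.2]
    have := hcast s
    rw [h0] at this
    simp only [f]
    rw [div_eq_div_iff h1.ne' h2.ne']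
    push_cast at this
    linarith

lemma next_edge (e : ℤ) (he : e ≠ 0) (S : Finset (ℤ × ℤ)) (p r : ℤ × ℤ) (hE : HEdge e S p r)
    (h : ∃ s ∈ S, r.1 < s.1) : ∃ t, HEdge e S r t ∧ 0 < e * cross (r - p) (t - r) := by
  obtain ⟨hp, hr, hpr, hall⟩ := hE
  obtain ⟨t, ht, hrt, hm⟩ := next_point e S r h
  have hturn : 0 < e * cross (r - p) (t - r) := by
    have e1 : cross (r - p) (t - r) = cross (r - p) (t - p) := by
      unfold cross; simp only [Prod.fst_sub, Prod.snd_sub]; ring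
    rw [e1]
    obtain ⟨h1, h2⟩ := hall t ht
    rcases h1.lt_or_eq with h1 | h1
    · exact h1
    · exfalso
      have := h2 (by
        rcases mul_eq_zero.1 h1.symm with h | h
        · exact absurd h he
        · exact h)
      omega
  refine ⟨t, ⟨hr, ht, hrt, ?_⟩, hturn⟩
  intro s hs
  by_cases hrs : r.1 < s.1
  · exact hm s hs hrs
  · refine ⟨?_, fun _ => by omega⟩
    have h1 := (hall s hs).1
    -- (r-p).1 * cross (t-r) (s-r) = (t-r).1 * cross (r-p)(s-p) + (r-s).1 * cross (r-p)(t-r)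
    have key : (r.1 - p.1) * (e * cross (t - r) (s - r)) =
        (t.1 - r.1) * (e * cross (r - p) (s - p)) +
        (r.1 - s.1) * (e * cross (r - p) (t - r)) := by
      unfold cross; simp only [Prod.fst_sub, Prod.snd_sub]; ring
    have : 0 ≤ (r.1 - p.1) * (e * cross (t - r) (s - r)) := by
      rw [key]
      have a1 : 0 ≤ t.1 - r.1 := by omega
      have a2 : 0 ≤ r.1 - s.1 := by omega
      have := mul_nonneg a1 h1
      have := mul_nonneg a2 hturn.le
      linarith
    exact nonneg_of_mul_nonneg_right this (by omega)

lemma first_edge (e : ℤ) (S : Finset (ℤ × ℤ)) (p : ℤ × ℤ) (hp : p ∈ S)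
    (hx : ∀ s ∈ S, p.1 ≤ s.1) (hy : ∀ s ∈ S, s.1 = p.1 → 0 ≤ e * (s.2 - p.2))
    (h : ∃ s ∈ S, p.1 < s.1) : ∃ t, HEdge e S p t := by
  obtain ⟨t, ht, hpt, hm⟩ := next_point e S p h
  refine ⟨t, hp, ht, hpt, ?_⟩
  intro s hs
  by_cases hps : p.1 < s.1
  · exact hm s hs hps
  · have hsp : s.1 = p.1 := le_antisymm (by omega) (hx s hs)
    refine ⟨?_, fun _ => by omega⟩
    have h1 := hy s hs hsp
    have : e * cross (t - p) (s - p) = (t.1 - p.1) * (e * (s.2 - p.2)) := by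
      unfold cross; simp only [Prod.fst_sub, Prod.snd_sub, hsp]; ring
    rw [this]
    exact mul_nonneg (by omega) h1

lemma mkQuad {m : ℕ} {v : Fin m → ℕ} {S : Finset (ℤ × ℤ)} (hS : DigitalConvex S)
    (hc : ∀ i : Fin m, (S.filter (fun p => p.1 = (i : ℤ))).card = v i)
    (hR : ∀ p ∈ S, InRv m v p) {pl pr ql qr : ℤ × ℤ} (hL : HEdge 1 S pl pr)
    (hU : HEdge (-1) S ql qr) (ho : max pl.1 ql.1 ≤ min pr.1 qr.1) :
    ∃ q : Quad m v, q.pl = pl ∧ q.pr = pr ∧ q.ql = ql ∧ q.qr = qr := by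
  obtain ⟨hpl, hpr, hp, hLa⟩ := hL
  obtain ⟨hql, hqr, hq, hUa⟩ := hU
  have hL1 : ∀ s ∈ S, 0 ≤ cross (pr - pl) (s - pl) := fun s hs => by
    have := (hLa s hs).1; linarith
  have hU1 : ∀ s ∈ S, cross (qr - ql) (s - ql) ≤ 0 := fun s hs => by
    have := (hUa s hs).1; linarith
  refine ⟨⟨pl, pr, ql, qr, hp, hq, hR _ hpl, hR _ hpr, hR _ hql, hR _ hqr, ?_, ho, ?_⟩,
    rfl, rfl, rfl, rfl⟩
  · have a1 := hL1 qr hqr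
    have a2 := hL1 ql hql
    have a3 := hU1 pl hpl
    have a4 := hU1 pr hpr
    unfold cross at *
    simp only [Prod.fst_sub, Prod.snd_sub] at *
    refine ⟨?_, ?_, ?_, ?_⟩ <;> linarith
  · intro i hi1 hi2
    have b1 : pl.1 ≤ (i : ℤ) := (le_max_left _ _).trans hi1
    have b2 : ql.1 ≤ (i : ℤ) := (le_max_right _ _).trans hi1
    have b3 : (i : ℤ) ≤ pr.1 := hi2.trans (min_le_left _ _)
    have b4 : (i : ℤ) ≤ qr.1 := hi2.trans (min_le_right _ _)
    have hfil : S.filter (fun p => p.1 = (i : ℤ)) =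
        (Finset.Icc ⌈yLine pl pr i⌉ ⌊yLine ql qr i⌋).image fun y => ((i : ℤ), y) := by
      ext ⟨x, y⟩
      simp only [Finset.mem_filter, Finset.mem_image, Finset.mem_Icc, Int.ceil_le, Int.le_floor,
        Prod.mk.injEq]
      constructor
      · rintro ⟨h1, rfl⟩
        exact ⟨y, ⟨(yLine_le_iff _ _ hp _ _).2 (hL1 _ h1), (le_yLine_iff _ _ hq _ _).2 (hU1 _ h1)⟩,
          rfl, rfl⟩
      · rintro ⟨y, ⟨h1, h2⟩, rfl, rfl⟩
        refine ⟨fill hS _ _ _ _ (seg_mem hpl hpr hp _ b1 b3) (seg_mem hql hqr hq _ b2 b4) ?_ ?_, rfl⟩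
        · exact_mod_cast h1
        · exact_mod_cast h2
    have hcard := hc i
    rw [hfil, Finset.card_image_of_injective _ (by intro a b h; simpa using h),
      Int.card_Icc] at hcard
    have hle : yLine pl pr i ≤ yLine ql qr i := by
      have a3 := (le_yLine_iff ql qr hq pl.1 pl.2).2 (hU1 pl hpl)
      have a4 := (le_yLine_iff ql qr hq pr.1 pr.2).2 (hU1 pr hpr)
      have d1 : (pl.1 : ℚ) < pr.1 := by exact_mod_cast hp
      have d2 : (pl.1 : ℚ) ≤ (i : ℤ) := by exact_mod_cast b1
      have d3 : ((i : ℤ) : ℚ) ≤ pr.1 := by exact_mod_cast b3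
      rw [← evL_lineOf] at a3 a4 ⊢
      rw [← evL_lineOf ql qr]
      set u := lineOf ql qr
      have hd : (0 : ℚ) < pr.1 - pl.1 := by linarith
      have e1 : evL (lineOf pl pr) i =
        ((pr.1 - (i : ℤ)) * pl.2 + ((i : ℤ) - pl.1) * pr.2) / (pr.1 - pl.1) := by
        rw [evL_expand_left]; field_simp; ring
      rw [e1, div_le_iff₀ hd]
      have f1 := mul_le_mul_of_nonneg_left a3 (sub_nonneg.2 d3)
      have f2 := mul_le_mul_of_nonneg_left a4 (sub_nonneg.2 d2)
      have f3 : evL u i * (pr.1 - pl.1) =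
          (pr.1 - (i : ℤ)) * evL u pl.1 + ((i : ℤ) - pl.1) * evL u pr.1 := by
        unfold evL; ring
      linarith
    have : ⌈yLine pl pr i⌉ ≤ ⌊yLine ql qr i⌋ + 1 := by
      rw [Int.ceil_le]
      push_cast
      exact hle.trans (Int.lt_floor_add_one _).le
    omega

lemma walk {m : ℕ} {v : Fin m → ℕ} {S : Finset (ℤ × ℤ)} (hS : DigitalConvex S)
    (hb : ∀ p ∈ S, 0 ≤ p.1 ∧ p.1 ≤ (m : ℤ) - 1)
    (hc : ∀ i : Fin m, (S.filter (fun p => p.1 = (i : ℤ))).card = v i)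
    (hR : ∀ p ∈ S, InRv m v p) (hlast : ∃ s ∈ S, s.1 = (m : ℤ) - 1) (n : ℕ) :
    ∀ q : Quad m v, HEdge 1 S q.pl q.pr → HEdge (-1) S q.ql q.qr →
      ((m : ℤ) - 1 - q.pr.1) + ((m : ℤ) - 1 - q.qr.1) ≤ n →
      ∃ b : Quad m v, b.pr.1 = (m : ℤ) - 1 ∧ b.qr.1 = (m : ℤ) - 1 ∧
        Relation.ReflTransGen QuadEdge q b := by
  obtain ⟨z, hz, hzm⟩ := hlast
  induction n with
  | zero =>
    intro q h1 h2 hn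
    have e1 := (hb _ h1.2.1).2
    have e2 := (hb _ h2.2.1).2
    exact ⟨q, by push_cast at hn; omega, by push_cast at hn; omega, .refl⟩
  | succ n ih =>
    intro q h1 h2 hn
    push_cast at hn
    have e1 := (hb _ h1.2.1).2
    have e2 := (hb _ h2.2.1).2
    have o := q.overlap
    have n1 := q.lower_nonvert
    have n2 := q.upper_nonvert
    by_cases hc1 : q.pr.1 ≤ q.qr.1 ∧ q.pr.1 < (m : ℤ) - 1
    · obtain ⟨t, ht, hturn⟩ := next_edge 1 one_ne_zero S _ _ h1 ⟨z, hz, by omega⟩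
      have hlt := ht.2.2.1
      obtain ⟨q', f1, f2, f3, f4⟩ := mkQuad hS hc hR ht h2 (by omega)
      obtain ⟨b, hb1, hb2, hb3⟩ := ih q' (by rw [f1, f2]; exact ht) (by rw [f3, f4]; exact h2)
        (by rw [f2, f4]; omega)
      refine ⟨b, hb1, hb2, .head (Or.inr ⟨f3.symm, f4.symm, f1.symm, ?_⟩) hb3⟩
      rw [f1, f2]; linarith
    · by_cases hc2 : q.qr.1 < (m : ℤ) - 1
      · obtain ⟨t, ht, hturn⟩ := next_edge (-1) (by norm_num) S _ _ h2 ⟨z, hz, by omega⟩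
        have hlt := ht.2.2.1
        obtain ⟨q', f1, f2, f3, f4⟩ := mkQuad hS hc hR h1 ht (by omega)
        obtain ⟨b, hb1, hb2, hb3⟩ := ih q' (by rw [f1, f2]; exact h1) (by rw [f3, f4]; exact ht)
          (by rw [f2, f4]; omega)
        refine ⟨b, hb1, hb2, .head (Or.inl ⟨f1.symm, f2.symm, f3.symm, ?_⟩) hb3⟩
        rw [f3, f4]; linarith
      · exact ⟨q, by omega, by omega, .refl⟩

/-- lattice shear -/
def shear (k c : ℤ) (p : ℤ × ℤ) : ℤ × ℤ := (p.1, p.2 + k * p.1 + c)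

lemma shear_inj (k c : ℤ) : Function.Injective (shear k c) := by
  rintro ⟨a, b⟩ ⟨a', b'⟩ h
  simp only [shear, Prod.mk.injEq] at h
  obtain ⟨rfl, h⟩ := h
  simp only [Prod.mk.injEq, true_and]
  linarith

lemma shear_convex (k c : ℤ) {S : Finset (ℤ × ℤ)} (hS : DigitalConvex S) :
    DigitalConvex (S.image (shear k c)) := by
  intro p hp
  let K : Set (ℝ × ℝ) := {z | (z.1, z.2 - k * z.1 - c) ∈ convexHull ℝ (emb '' (S : Set (ℤ × ℤ)))}
  have hK : Convex ℝ K := by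
    intro x hx y hy s t hs ht hst
    have := convex_convexHull ℝ (emb '' (S : Set (ℤ × ℤ))) hx hy hs ht hst
    change (_, _) ∈ convexHull ℝ (emb '' (S : Set (ℤ × ℤ)))
    convert this using 1
    simp only [Prod.smul_mk, Prod.mk_add_mk, Prod.mk.injEq, Prod.fst_add, Prod.snd_add,
      Prod.smul_fst, Prod.smul_snd, smul_eq_mul, true_and]
    have : (c : ℝ) = s * c + t * c := by rw [← add_mul, hst, one_mul]
    linear_combination -this
  have hsub : ((fun q : ℤ × ℤ => ((q.1 : ℝ), (q.2 : ℝ))) '' ↑(S.image (shear k c))) ⊆ K := by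
    rintro _ ⟨q, hq, rfl⟩
    rw [Finset.mem_coe, Finset.mem_image] at hq
    obtain ⟨s, hs, rfl⟩ := hq
    apply subset_convexHull
    refine ⟨s, hs, ?_⟩
    simp only [emb, shear]
    push_cast
    ext
    · simp
    · simp only; ring
  have h := convexHull_min hsub hK hp
  rw [Finset.mem_image]
  refine ⟨(p.1, p.2 - k * p.1 - c), hS _ ?_, ?_⟩
  · have h' : ((p.1 : ℝ), (p.2 : ℝ) - k * p.1 - c) ∈ convexHull ℝ (emb '' (S : Set (ℤ × ℤ))) := h
    push_cast
    exact h'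
  · unfold shear
    ext
    · simp
    · simp only; ring

lemma inRv_of {m : ℕ} {v : Fin m → ℕ} {S : Finset (ℤ × ℤ)} (hS : DigitalConvex S)
    (hb : ∀ p ∈ S, 0 ≤ p.1 ∧ p.1 ≤ (m : ℤ) - 1)
    (hc : ∀ i : Fin m, (S.filter (fun p => p.1 = (i : ℤ))).card = v i) (hm : 2 ≤ m)
    (h0 : ((0 : ℤ), (0 : ℤ)) ∈ S) (h : ℤ) (hh0 : 0 ≤ h) (hh1 : h ≤ (m : ℤ) - 1)
    (hl : ((m : ℤ) - 1, h) ∈ S) : ∀ p ∈ S, InRv m v p := by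
  rintro ⟨x, y⟩ hp
  obtain ⟨b1, b2⟩ := hb _ hp
  simp only at b1 b2
  obtain ⟨n, rfl⟩ := Int.eq_ofNat_of_zero_le b1
  let i : Fin m := ⟨n, by omega⟩
  have hlt : ((0 : ℤ), (0 : ℤ)).1 < (((m : ℤ) - 1, h) : ℤ × ℤ).1 := by simp only; omega
  have hseg := seg_mem h0 hl hlt (n : ℤ) b1 b2
  have hpt : emb ((n : ℤ), y) ∈ convexHull ℝ (emb '' (S : Set (ℤ × ℤ))) :=
    subset_convexHull ℝ _ ⟨_, hp, rfl⟩
  have y0 : ((0 : ℤ) : ℚ) ≤ yLine (0, 0) ((m : ℤ) - 1, h) n := by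
    rw [le_yLine_iff _ _ hlt]
    unfold cross
    simp only [Prod.fst_sub, Prod.snd_sub]
    have := mul_nonneg hh0 b1
    simp at *
    linarith
  have y1 : yLine (0, 0) ((m : ℤ) - 1, h) n ≤ ((n : ℤ) : ℚ) := by
    rw [yLine_le_iff _ _ hlt]
    unfold cross
    simp only [Prod.fst_sub, Prod.snd_sub]
    have := mul_le_mul_of_nonneg_right hh1 b1
    simp at *
    linarith
  have y0' : ((0 : ℤ) : ℝ) ≤ ((yLine (0, 0) ((m : ℤ) - 1, h) n : ℚ) : ℝ) := by exact_mod_cast y0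
  have y1' : ((yLine (0, 0) ((m : ℤ) - 1, h) n : ℚ) : ℝ) ≤ ((n : ℤ) : ℝ) := by exact_mod_cast y1
  have hcount : ∀ c d : ℤ, (∀ z, c ≤ z → z ≤ d → ((n : ℤ), z) ∈ S) → d + 1 - c ≤ (v i : ℤ) := by
    intro c d hcd
    have hsub : (Finset.Icc c d).image (fun y => ((n : ℤ), y)) ⊆
        S.filter (fun p => p.1 = (i : ℤ)) := by
      intro q hq
      simp only [Finset.mem_image, Finset.mem_Icc] at hq
      obtain ⟨z, ⟨h1, h2⟩, rfl⟩ := hq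
      rw [Finset.mem_filter]
      exact ⟨hcd z h1 h2, rfl⟩
    have := Finset.card_le_card hsub
    rw [hc i, Finset.card_image_of_injective _ (by intro a b h; simpa using h),
      Int.card_Icc] at this
    omega
  have hv1 : y + 1 - y ≤ (v i : ℤ) := by
    apply hcount
    intro z h1 h2
    rw [le_antisymm h2 h1]; exact hp
  refine ⟨i, rfl, ?_, ?_⟩
  · simp only
    by_cases hy : y < 0
    · have := hcount y 0 (by
        intro z h1 h2
        refine fill hS _ _ _ _ hpt hseg (by exact_mod_cast h1) (le_trans ?_ y0')
        exact_mod_cast h2)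
      omega
    · omega
  · simp only
    have hi : ((i : ℕ) : ℤ) = n := rfl
    rw [hi]
    by_cases hy : (n : ℤ) < y
    · have := hcount n y (by
        intro z h1 h2
        refine fill hS _ _ _ _ hseg hpt (y1'.trans ?_) (by exact_mod_cast h2)
        exact_mod_cast h1)
      omega
    · omega

lemma yLine_left (a b : ℤ × ℤ) : yLine a b a.1 = a.2 := by
  unfold yLine; simp

lemma yLine_right (a b : ℤ × ℤ) (h : a.1 < b.1) : yLine a b b.1 = b.2 := by
  have h' : (0 : ℚ) < (b.1 : ℚ) - a.1 := by
    have : (a.1 : ℚ) < b.1 := by exact_mod_cast h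
    linarith
  unfold yLine; field_simp; ring

lemma forward (m : ℕ) (hm : 2 ≤ m) (v : Fin m → ℕ) (S : Finset (ℤ × ℤ)) (hS : DigitalConvex S)
    (hb : ∀ p ∈ S, 0 ≤ p.1 ∧ p.1 ≤ (m : ℤ) - 1)
    (hc : ∀ i : Fin m, (S.filter (fun p => p.1 = (i : ℤ))).card = v i)
    (h0 : ((0 : ℤ), (0 : ℤ)) ∈ S) (h0' : ∀ y, ((0 : ℤ), y) ∈ S → 0 ≤ y)
    (h : ℤ) (hh0 : 0 ≤ h) (hh1 : h ≤ (m : ℤ) - 1) (hl : ((m : ℤ) - 1, h) ∈ S) :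
    ∃ a b : Quad m v,
      (a.pl = ((0 : ℤ), (0 : ℤ)) ∧ a.ql = ((0 : ℤ), (v ⟨0, by omega⟩ : ℤ) - 1)) ∧
      (b.pr.1 = (m : ℤ) - 1 ∧ b.qr.1 = (m : ℤ) - 1 ∧
        b.qr.2 = b.pr.2 + (v ⟨m - 1, by omega⟩ : ℤ) - 1) ∧
      Relation.ReflTransGen QuadEdge a b := by
  have hR := inRv_of hS hb hc hm h0 h hh0 hh1 hl
  obtain ⟨pr, hpr⟩ := first_edge 1 S (0, 0) h0 (fun s hs => (hb s hs).1) (by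
    rintro ⟨x, y⟩ hs hx
    simp only at hx
    subst hx
    have := h0' y hs
    simp only
    linarith) ⟨_, hl, by simp only; omega⟩
  obtain ⟨ql, hql, hqmax⟩ := (S.filter (fun p => p.1 = 0)).exists_max_image (fun s => s.2)
    ⟨(0, 0), by simp [h0]⟩
  rw [Finset.mem_filter] at hql
  obtain ⟨qr, hqr⟩ := first_edge (-1) S ql hql.1
    (fun s hs => by rw [hql.2]; exact (hb s hs).1) (by
    intro s hs hx
    have := hqmax s (Finset.mem_filter.2 ⟨hs, by rw [hx, hql.2]⟩)
    linarith) ⟨_, hl, by simp only; omega⟩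
  have l1 := hpr.2.2.1
  have l2 := hqr.2.2.1
  simp only at l1
  obtain ⟨a, a1, a2, a3, a4⟩ := mkQuad hS hc hR hpr hqr (by simp only; omega)
  obtain ⟨b, b1, b2, b3⟩ := walk hS hb hc hR ⟨_, hl, rfl⟩
    (((m : ℤ) - 1 - a.pr.1) + ((m : ℤ) - 1 - a.qr.1)).toNat a
    (by rw [a1, a2]; exact hpr) (by rw [a3, a4]; exact hqr) (Int.self_le_toNat _)
  refine ⟨a, b, ⟨a1, ?_⟩, ⟨b1, b2, ?_⟩, b3⟩
  · have hcnt := a.count ⟨0, by omega⟩ (by rw [a1, a3]; simp only; omega)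
      (by rw [a2, a4]; simp only; omega)
    have e1 : ((((⟨0, by omega⟩ : Fin m) : ℕ) : ℤ)) = a.pl.1 := by rw [a1]; rfl
    have e2 : ((((⟨0, by omega⟩ : Fin m) : ℕ) : ℤ)) = a.ql.1 := by rw [a3, hql.2]; rfl
    have g1 : yLine a.pl a.pr (((⟨0, by omega⟩ : Fin m) : ℕ) : ℤ) = a.pl.2 := by
      rw [e1, yLine_left]
    have g2 : yLine a.ql a.qr (((⟨0, by omega⟩ : Fin m) : ℕ) : ℤ) = a.ql.2 := by
      rw [e2, yLine_left]
    rw [g1, g2, Int.floor_intCast, Int.ceil_intCast, a1] at hcnt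
    simp only at hcnt
    ext
    · rw [a3, hql.2]
    · simp only
      omega
  · have hi : ((((⟨m - 1, by omega⟩ : Fin m) : ℕ) : ℤ)) = (m : ℤ) - 1 := by
      simp only; omega
    have n1 := b.lower_nonvert
    have n2 := b.upper_nonvert
    have hcnt := b.count ⟨m - 1, by omega⟩ (by rw [hi]; omega) (by rw [hi]; omega)
    have g1 : yLine b.pl b.pr (((⟨m - 1, by omega⟩ : Fin m) : ℕ) : ℤ) = b.pr.2 := by
      rw [hi, ← b1, yLine_right _ _ n1]
    have g2 : yLine b.ql b.qr (((⟨m - 1, by omega⟩ : Fin m) : ℕ) : ℤ) = b.qr.2 := by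
      rw [hi, ← b2, yLine_right _ _ n2]
    rw [g1, g2, Int.floor_intCast, Int.ceil_intCast] at hcnt
    omega

/-- a digital convex set `S ⊆ [0,m-1] × ℤ` with vertical X-ray `v`
(`v₀, v_{m-1} ≥ 1`) exists iff there is a path from the set `Left` to the set `Right`
in the DAG `Γ(v)` of quads. -/
theorem dag_reconstruction_one_xray (m : ℕ) (hm : 2 ≤ m) (v : Fin m → ℕ)
    (hv0 : 1 ≤ v ⟨0, by omega⟩) (hvm : 1 ≤ v ⟨m - 1, by omega⟩) :
    (∃ S : Finset (ℤ × ℤ), DigitalConvex S ∧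
      (∀ p ∈ S, 0 ≤ p.1 ∧ p.1 ≤ (m : ℤ) - 1) ∧
      (∀ i : Fin m, (S.filter (fun p => p.1 = (i : ℤ))).card = v i)) ↔
    (∃ a b : Quad m v,
      (a.pl = ((0 : ℤ), (0 : ℤ)) ∧ a.ql = ((0 : ℤ), (v ⟨0, by omega⟩ : ℤ) - 1)) ∧
      (b.pr.1 = (m : ℤ) - 1 ∧ b.qr.1 = (m : ℤ) - 1 ∧
        b.qr.2 = b.pr.2 + (v ⟨m - 1, by omega⟩ : ℤ) - 1) ∧
      Relation.ReflTransGen QuadEdge a b) := by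
  constructor
  · rintro ⟨S, hS, hb, hc⟩
    have hne : ∀ i : Fin m, 1 ≤ v i → ∃ y, ((i : ℤ), y) ∈ S ∧ ∀ z, ((i : ℤ), z) ∈ S → y ≤ z := by
      intro i hi
      rw [← hc i] at hi
      have hi' : (S.filter (fun p => p.1 = (i : ℤ))).Nonempty := Finset.card_pos.1 hi
      obtain ⟨p, hp, hmin⟩ := Finset.exists_min_image _ (fun s => s.2) hi'
      rw [Finset.mem_filter] at hp
      refine ⟨p.2, ?_, ?_⟩
      · rw [← hp.2]; exact hp.1
      · intro z hz
        exact hmin _ (Finset.mem_filter.2 ⟨hz, rfl⟩)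
    obtain ⟨y0, hy0, hy0'⟩ := hne _ hv0
    obtain ⟨y1, hy1, -⟩ := hne _ hvm
    have hm1 : (((m - 1 : ℕ)) : ℤ) = (m : ℤ) - 1 := by omega
    simp only [Nat.cast_zero] at hy0 hy0'
    simp only [hm1] at hy1
    have hN : (0 : ℤ) < (m : ℤ) - 1 := by omega
    let k : ℤ := -((y1 - y0) / ((m : ℤ) - 1))
    refine forward m hm v (S.image (shear k (-y0))) (shear_convex _ _ hS) ?_ ?_ ?_ ?_
      ((y1 - y0) % ((m : ℤ) - 1)) (Int.emod_nonneg _ hN.ne') (Int.emod_lt_of_pos _ hN).le ?_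
    · intro p hp
      obtain ⟨s, hs, rfl⟩ := Finset.mem_image.1 hp
      exact hb s hs
    · intro i
      rw [Finset.filter_image, Finset.card_image_of_injective _ (shear_inj _ _)]
      exact hc i
    · refine Finset.mem_image.2 ⟨_, hy0, ?_⟩
      simp [shear]
    · intro y hy
      obtain ⟨⟨x, z⟩, hs, he⟩ := Finset.mem_image.1 hy
      simp only [shear, Prod.mk.injEq] at he
      obtain ⟨rfl, rfl⟩ := he
      have := hy0' z hs
      linarith
    · refine Finset.mem_image.2 ⟨_, hy1, ?_⟩
      simp only [shear, k, Prod.mk.injEq, true_and]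
      have := Int.emod_add_mul_ediv (y1 - y0) ((m : ℤ) - 1)
      linarith
  · rintro ⟨a, b, ⟨ha1, ha2⟩, ⟨hb1, hb2, -⟩, hpath⟩
    obtain ⟨A, B, hinv⟩ := pathInv_exists a b (by rw [ha1]) (by rw [ha2]) hpath
    exact backward m v b A B hb1 hb2 hinv
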